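/- arXiv:2408.13481 — 3 statements merged into one kernel-verified Lean document; each statement's English description precedes it below -/
import Mathlib

section
/- Let K be a field of characteristic p > 0 with p ∣ n, and let f(x) = x^n + y₁x^{n−1} + ⋯ + y_n be a separable Eisenstein polynomial over K⟦t⟧ defining the extension L = K((t))[x]/(f) with uniformizer ϖ (the image of x). Then the discriminant exponent of L/K((t)) equals min over i ∈ {0,…,n−1} with p ∤ (n−i) of (n−i−1 + n·ord(yᵢ)), where y₀ = 1 and ord denotes the t-adic valuation. -/
open Polynomial in
/-- The discriminant of the power basis of `R[X]/(f)` is, up to sign, the norm of the derivative of `f` at the root. -/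
theorem AdjoinRoot.discr_powerBasis'_eq_norm {R : Type*} (F : Type*) [CommRing R] [IsDomain R]
    [IsIntegrallyClosed R] [Field F] [Algebra R F] [IsFractionRing R F] {f : R[X]} (hmon : f.Monic)
    (hf : Prime f) (hsep : (f.map (algebraMap R F)).Separable) :
    Algebra.discr R (AdjoinRoot.powerBasis' hmon).basis =
      (-1) ^ (f.natDegree * (f.natDegree - 1) / 2) *
        Algebra.norm R (aeval (AdjoinRoot.root f) (derivative f)) := by
  have : IsDomain (AdjoinRoot f) := AdjoinRoot.isDomain_of_prime hf
  have : Module.Finite R (AdjoinRoot f) := hmon.finite_adjoinRoot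
  have : Module.Free R (AdjoinRoot f) := hmon.free_adjoinRoot
  have hinj : Function.Injective (algebraMap R (FractionRing (AdjoinRoot f))) :=
    FaithfulSMul.algebraMap_injective _ _
  let : Algebra F (FractionRing (AdjoinRoot f)) := (IsFractionRing.lift hinj).toAlgebra
  have : IsScalarTower R F (FractionRing (AdjoinRoot f)) :=
    .of_algebraMap_eq fun x => (IsFractionRing.lift_algebraMap hinj x).symm
  let pb : PowerBasis F (FractionRing (AdjoinRoot f)) :=
    { gen := algebraMap (AdjoinRoot f) _ (AdjoinRoot.root f)
      dim := (AdjoinRoot.powerBasis' hmon).dim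
      basis := (AdjoinRoot.powerBasis' hmon).basis.localizationLocalization F
        (nonZeroDivisors R) (FractionRing (AdjoinRoot f))
      basis_eq_pow := fun i => by
        rw [Module.Basis.localizationLocalization_apply, PowerBasis.basis_eq_pow, map_pow]
        rfl }
  have hminpoly : minpoly F pb.gen = f.map (algebraMap R F) := by
    refine (minpoly.eq_of_irreducible_of_monic
      ((hmon.irreducible_iff_irreducible_map_fraction_map).1 hf.irreducible) ?_ (hmon.map _)).symm
    rw [aeval_map_algebraMap, aeval_algebraMap_apply, AdjoinRoot.aeval_eq, AdjoinRoot.mk_self,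
      map_zero]
  have := pb.finite
  have : Algebra.IsSeparable F (FractionRing (AdjoinRoot f)) := by
    have htop : IntermediateField.adjoin F {pb.gen} = ⊤ := by
      rw [eq_top_iff, ← IntermediateField.toSubalgebra_le_toSubalgebra,
        IntermediateField.top_toSubalgebra, ← pb.adjoin_gen_eq_top]
      exact IntermediateField.algebra_adjoin_le_adjoin _ _
    rw [← IntermediateField.isSeparable_top, ← htop,
      IntermediateField.isSeparable_adjoin_simple_iff_isSeparable, IsSeparable, hminpoly]
    exact hsep
  have h := Algebra.discr_powerBasis_eq_norm F pb
  rw [hminpoly, derivative_map, aeval_map_algebraMap, aeval_algebraMap_apply,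
    Algebra.norm_localization R (nonZeroDivisors R), pb.finrank] at h
  apply IsFractionRing.injective R F
  rw [← Algebra.discr_localizationLocalization R (nonZeroDivisors R)
    (FractionRing (AdjoinRoot f)), map_mul, map_pow, map_neg, map_one]
  exact h

/-- A nonzero power series over a field is a unit times a power of `X`. -/
theorem PowerSeries.exists_unit_mul_X_pow_of_order_eq {K : Type*} [Field K] {c : PowerSeries K}
    {o : ℕ} (hc : c.order = o) : ∃ u : (PowerSeries K)ˣ, c = (u : PowerSeries K) * PowerSeries.X ^ o := by
  have hc0 : c ≠ 0 := by
    rintro rfl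
    simp at hc
  have ho : c.order.toNat = o := by simp [hc]
  refine ⟨PowerSeries.Unit_of_divided_by_X_pow_order c, ?_⟩
  rw [PowerSeries.Unit_of_divided_by_X_pow_order_nonzero hc0, mul_comm, ← ho,
    PowerSeries.X_pow_order_mul_divXPowOrder]

section Eisenstein

open Polynomial

variable {K : Type*} [Field K] {f : (PowerSeries K)[X]}

/-- An Eisenstein polynomial has the form `Xⁿ + t * g` with `g(0)` a unit. -/
theorem Polynomial.exists_eq_X_pow_add_C_X_mul_of_order (hmon : f.Monic)
    (hcoeff : ∀ i < f.natDegree, 0 < (f.coeff i).order) (hconst : (f.coeff 0).order = 1)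
    (hn : 0 < f.natDegree) :
    ∃ g : (PowerSeries K)[X], IsUnit (g.coeff 0) ∧
      f = X ^ f.natDegree + C PowerSeries.X * g := by
  have hdvd : C PowerSeries.X ∣ f - X ^ f.natDegree := by
    rw [C_dvd_iff_dvd_coeff]
    intro i
    rw [coeff_sub, coeff_X_pow]
    rcases lt_trichotomy i f.natDegree with hi | rfl | hi
    · rw [if_neg hi.ne, sub_zero, PowerSeries.X_dvd_iff,
        ← PowerSeries.coeff_zero_eq_constantCoeff_apply]
      exact PowerSeries.coeff_of_lt_order 0 (by simpa using hcoeff i hi)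
    · simp [hmon.coeff_natDegree]
    · simp [hi.ne', coeff_eq_zero_of_natDegree_lt hi]
  obtain ⟨g, hg⟩ := hdvd
  refine ⟨g, ?_, by rw [← hg]; ring⟩
  have h0 : f.coeff 0 = PowerSeries.X * g.coeff 0 := by
    have := congrArg (coeff · 0) hg
    simpa [coeff_X_pow, hn.ne] using this
  obtain ⟨u, hu⟩ := PowerSeries.exists_unit_mul_X_pow_of_order_eq (o := 1) (by simpa using hconst)
  rw [pow_one, mul_comm, h0] at hu
  rw [mul_left_cancel₀ PowerSeries.X_ne_zero hu]
  exact u.isUnit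

theorem Polynomial.prime_of_order_coeff_pos (hmon : f.Monic)
    (hcoeff : ∀ i < f.natDegree, 0 < (f.coeff i).order) (hconst : (f.coeff 0).order = 1)
    (hn : 0 < f.natDegree) : Prime f := by
  have hP : (Ideal.span {(PowerSeries.X : PowerSeries K)}).IsPrime :=
    PowerSeries.span_X_isPrime
  refine UniqueFactorizationMonoid.irreducible_iff_prime.1
    (IsEisensteinAt.irreducible (𝓟 := Ideal.span {PowerSeries.X}) ⟨?_, fun {i} hi => ?_, ?_⟩
      hP hmon.isPrimitive hn)
  · rw [hmon.leadingCoeff]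
    exact fun h => hP.ne_top ((Ideal.eq_top_iff_one _).2 h)
  · rw [Ideal.mem_span_singleton, PowerSeries.X_dvd_iff,
      ← PowerSeries.coeff_zero_eq_constantCoeff_apply]
    exact PowerSeries.coeff_of_lt_order 0 (by simpa using hcoeff i hi)
  · rw [Ideal.span_singleton_pow, Ideal.mem_span_singleton, PowerSeries.X_pow_dvd_iff]
    intro h
    have := PowerSeries.nat_le_order _ 2 h
    rw [hconst] at this
    exact absurd this (by norm_num)

/-- In the ring defined by an Eisenstein polynomial, the root lies in the Jacobson radical, and the
uniformizer of the base is a unit times the `n`-th power of the root. -/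
theorem AdjoinRoot.isUnit_add_root_mul_and_exists_unit_of_order (hmon : f.Monic)
    (hcoeff : ∀ i < f.natDegree, 0 < (f.coeff i).order) (hconst : (f.coeff 0).order = 1)
    (hn : 0 < f.natDegree) :
    (∀ u s : AdjoinRoot f, IsUnit u → IsUnit (u + root f * s)) ∧
      ∃ w : (AdjoinRoot f)ˣ, algebraMap (PowerSeries K) (AdjoinRoot f) PowerSeries.X =
        w * root f ^ f.natDegree := by
  obtain ⟨g, hg, hfg⟩ :=
    exists_eq_X_pow_add_C_X_mul_of_order hmon hcoeff hconst hn
  have : Module.Finite (PowerSeries K) (AdjoinRoot f) := hmon.finite_adjoinRoot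
  have hroot : root f ^ f.natDegree =
      -(algebraMap (PowerSeries K) (AdjoinRoot f) PowerSeries.X * aeval (root f) g) := by
    have h0 : aeval (root f) f = 0 := by rw [aeval_eq, mk_self]
    have h1 : aeval (root f) f = root f ^ f.natDegree +
        algebraMap (PowerSeries K) (AdjoinRoot f) PowerSeries.X * aeval (root f) g := by
      simpa using congrArg (aeval (root f)) hfg
    exact eq_neg_of_add_eq_zero_left (h1 ▸ h0)
  have hunit (u s : AdjoinRoot f) (hu : IsUnit u) : IsUnit (u + root f * s) := by
    by_contra h
    obtain ⟨M, hM, hmem⟩ := exists_max_ideal_of_mem_nonunits h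
    have hX : algebraMap (PowerSeries K) (AdjoinRoot f) PowerSeries.X ∈ M := by
      rw [← Ideal.mem_comap, IsLocalRing.eq_maximalIdeal
        (Ideal.isMaximal_comap_of_isIntegral_of_isMaximal (R := PowerSeries K) M),
        PowerSeries.maximalIdeal_eq_span_X]
      exact Ideal.mem_span_singleton_self _
    have hr : root f ∈ M := hM.isPrime.mem_of_pow_mem f.natDegree (by
      rw [hroot]
      exact M.neg_mem (M.mul_mem_right _ hX))
    exact hM.ne_top (M.eq_top_of_isUnit_mem
      ((M.add_mem_iff_left (M.mul_mem_right s hr)).1 hmem) hu)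
  refine ⟨hunit, ?_⟩
  have hgu : IsUnit (aeval (root f) g) := by
    have : aeval (root f) g = algebraMap (PowerSeries K) _ (g.coeff 0) +
        root f * aeval (root f) g.divX := by
      conv_lhs => rw [← X_mul_divX_add g, add_comm, map_add, map_mul, aeval_X, aeval_C]
    rw [this]
    exact hunit _ _ (hg.map _)
  obtain ⟨v, hv⟩ := hgu
  refine ⟨-v⁻¹, ?_⟩
  rw [hroot, ← hv, Units.val_neg, neg_mul_neg, mul_left_comm, Units.inv_mul, mul_one]

/-- The norm from an Eisenstein extension of `K⟦t⟧` preserves normalized valuations: the order of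
the norm of `∑ cₖ ϖᵏ` is `min (k + n * ord cₖ)`. -/
theorem AdjoinRoot.order_norm_sum_of_order (hmon : f.Monic)
    (hcoeff : ∀ i < f.natDegree, 0 < (f.coeff i).order) (hconst : (f.coeff 0).order = 1)
    (hn : 0 < f.natDegree) (c : ℕ → PowerSeries K) :
    (Algebra.norm (PowerSeries K) (∑ k ∈ Finset.range f.natDegree,
      algebraMap (PowerSeries K) (AdjoinRoot f) (c k) * root f ^ k)).order =
      (Finset.range f.natDegree).inf
        fun k => (k : ℕ∞) + (f.natDegree : ℕ∞) * (c k).order := by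
  obtain ⟨hunit, w, hw⟩ := isUnit_add_root_mul_and_exists_unit_of_order hmon hcoeff hconst hn
  have : Module.Finite (PowerSeries K) (AdjoinRoot f) := hmon.finite_adjoinRoot
  have : Module.Free (PowerSeries K) (AdjoinRoot f) := hmon.free_adjoinRoot
  have hnu (u : AdjoinRoot f) (hu : IsUnit u) : (Algebra.norm (PowerSeries K) u).order = 0 :=
    PowerSeries.order_zero_of_unit (hu.map _)
  have hn' : (f.natDegree : ℕ∞) ≠ 0 := by exact_mod_cast hn.ne'
  have hnr : (Algebra.norm (PowerSeries K) (root f)).order = 1 := by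
    have h := congrArg (fun z => (Algebra.norm (PowerSeries K) z).order) hw
    simp only [map_mul, map_pow, PowerSeries.order_mul, PowerSeries.order_pow,
      hnu _ w.isUnit, zero_add] at h
    rw [Algebra.norm_algebraMap_of_basis (powerBasis' hmon).basis, PowerSeries.order_pow,
      Fintype.card_fin, PowerSeries.order_X] at h
    simp only [powerBasis'_dim, nsmul_eq_mul] at h
    generalize (Algebra.norm (PowerSeries K) (root f)).order = o at h ⊢
    induction o with
    | top => simp [ENat.mul_top hn'] at h
    | coe o =>
      have h : f.natDegree * 1 = f.natDegree * o := by exact_mod_cast h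
      exact_mod_cast (Nat.eq_of_mul_eq_mul_left hn h).symm
  have hterm (k o : ℕ) (ho : (c k).order = o) : ∃ u : (AdjoinRoot f)ˣ,
      algebraMap (PowerSeries K) (AdjoinRoot f) (c k) * root f ^ k =
        root f ^ (k + f.natDegree * o) * u := by
    obtain ⟨v, hv⟩ := PowerSeries.exists_unit_mul_X_pow_of_order_eq ho
    refine ⟨Units.map (algebraMap (PowerSeries K) (AdjoinRoot f)).toMonoidHom v * w ^ o, ?_⟩
    rw [hv, map_mul, map_pow, hw]
    simp
    ring
  obtain ⟨k₀, hk₀, hmin⟩ := Finset.exists_mem_eq_inf (Finset.range f.natDegree)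
    ⟨0, by simpa using hn⟩ fun k => (k : ℕ∞) + (f.natDegree : ℕ∞) * (c k).order
  rw [hmin]
  have hle (k) (hk : k ∈ Finset.range f.natDegree) :
      (k₀ : ℕ∞) + f.natDegree * (c k₀).order ≤ k + f.natDegree * (c k).order :=
    hmin ▸ Finset.inf_le hk
  rcases eq_or_ne (c k₀) 0 with h0 | h0
  · have hall (k) (hk : k ∈ Finset.range f.natDegree) : c k = 0 := by
      have := hle k hk
      rw [h0, PowerSeries.order_zero, ENat.mul_top hn', add_top, top_le_iff] at this
      by_contra hck
      rw [← PowerSeries.coe_toNat_order hck] at this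
      exact absurd this (by exact_mod_cast ENat.natCast_ne_top _)
    rw [Finset.sum_eq_zero fun k hk => by rw [hall k hk, map_zero, zero_mul], h0,
      PowerSeries.order_zero, ENat.mul_top hn', add_top]
    have := isDomain_of_prime (prime_of_order_coeff_pos hmon hcoeff hconst hn)
    rw [Algebra.norm_zero, PowerSeries.order_zero]
  · obtain ⟨o, ho⟩ : ∃ o : ℕ, (c k₀).order = o := ⟨_, (PowerSeries.coe_toNat_order h0).symm⟩
    obtain ⟨u, hu⟩ := hterm k₀ o ho
    have hdvd : root f ^ (k₀ + f.natDegree * o + 1) ∣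
        ∑ k ∈ (Finset.range f.natDegree).erase k₀,
          algebraMap (PowerSeries K) (AdjoinRoot f) (c k) * root f ^ k := by
      refine Finset.dvd_sum fun k hk => ?_
      obtain ⟨hne, hk⟩ := Finset.mem_erase.1 hk
      rcases eq_or_ne (c k) 0 with hck | hck
      · simp [hck]
      obtain ⟨o', ho'⟩ : ∃ o' : ℕ, (c k).order = o' :=
        ⟨_, (PowerSeries.coe_toNat_order hck).symm⟩
      obtain ⟨u', hu'⟩ := hterm k o' ho'
      rw [hu']
      refine Dvd.dvd.mul_right (pow_dvd_pow _ (Nat.lt_of_le_of_ne ?_ fun h => hne ?_)) _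
      · have := hle k hk
        rw [ho, ho'] at this
        exact_mod_cast this
      · have := congrArg (· % f.natDegree) h
        simpa [Nat.mod_eq_of_lt (Finset.mem_range.1 hk),
          Nat.mod_eq_of_lt (Finset.mem_range.1 hk₀)] using this.symm
    obtain ⟨s, hs⟩ := hdvd
    rw [← Finset.add_sum_erase _ _ hk₀, hu, hs, pow_succ, mul_assoc, ← mul_add, map_mul, map_pow,
      PowerSeries.order_mul, PowerSeries.order_pow, hnr, hnu _ (hunit _ _ u.isUnit), ho]
    simp

end Eisenstein


/-- For a field `K` of characteristic `p > 0` with `p ∣ n` and a separable Eisenstein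
polynomial `f = xⁿ + y₁xⁿ⁻¹ + ⋯ + yₙ` over `K⟦t⟧`, the discriminant exponent of the
extension `L = K((t))[x]/(f)` (the `t`-adic order of the discriminant of the power
basis `1, x, …, xⁿ⁻¹`) equals
`min { n−i−1 + n·ord(yᵢ) : 0 ≤ i ≤ n−1, p ∤ (n−i) }`, where `y₀ = 1`. -/
theorem stmt_4 (K : Type*) [Field K] (p : ℕ) [CharP K p] (hp : p ≠ 0)
    (n : ℕ) (hn : 0 < n) (hpn : p ∣ n)
    (f : Polynomial (PowerSeries K)) (hmon : f.Monic) (hdeg : f.natDegree = n)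
    (hcoeff : ∀ i < n, 0 < (f.coeff i).order)
    (hconst : (f.coeff 0).order = 1)
    (hsep : (f.map (algebraMap (PowerSeries K) (LaurentSeries K))).Separable) :
    (Algebra.discr (PowerSeries K) (AdjoinRoot.powerBasis' hmon).basis).order =
      ((Finset.range n).filter (fun i => ¬ p ∣ (n - i))).inf
        (fun i => ((n - i - 1 : ℕ) : ℕ∞) + (n : ℕ∞) * (f.coeff (n - i)).order) := by
  subst hdeg
  have hpf := Polynomial.prime_of_order_coeff_pos hmon hcoeff hconst hn
  rw [AdjoinRoot.discr_powerBasis'_eq_norm (LaurentSeries K) hmon hpf hsep]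
  have hsum : Polynomial.aeval (AdjoinRoot.root f) (Polynomial.derivative f) =
      ∑ k ∈ Finset.range f.natDegree, algebraMap (PowerSeries K) (AdjoinRoot f)
        (f.coeff (k + 1) * (k + 1 : ℕ)) * AdjoinRoot.root f ^ k := by
    rw [Polynomial.aeval_eq_sum_range' (Polynomial.natDegree_derivative_lt hn.ne')]
    refine Finset.sum_congr rfl fun k _ => ?_
    rw [Polynomial.coeff_derivative, Algebra.smul_def, Nat.cast_succ]
  rw [PowerSeries.order_mul, PowerSeries.order_zero_of_unit ((isUnit_one (M := PowerSeries K)).neg.pow _), zero_add,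
    hsum, AdjoinRoot.order_norm_sum_of_order hmon hcoeff hconst hn]
  have hcast (j : ℕ) : ((j : PowerSeries K)) = PowerSeries.C (j : K) := by simp
  have hn' : (f.natDegree : ℕ∞) ≠ 0 := by exact_mod_cast hn.ne'
  refine le_antisymm (Finset.le_inf fun i hi => ?_) (Finset.le_inf fun k hk => ?_)
  · obtain ⟨hi, hpi⟩ := Finset.mem_filter.1 hi
    rw [Finset.mem_range] at hi
    have hk : f.natDegree - i - 1 ∈ Finset.range f.natDegree := Finset.mem_range.2 (by omega)
    refine (Finset.inf_le hk).trans_eq ?_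
    have hu : IsUnit ((f.natDegree - i : ℕ) : PowerSeries K) := by
      rw [hcast]
      exact (isUnit_iff_ne_zero.2 (mt (CharP.cast_eq_zero_iff K p _).1 hpi)).map _
    rw [show f.natDegree - i - 1 + 1 = f.natDegree - i by omega, PowerSeries.order_mul,
      PowerSeries.order_zero_of_unit hu, add_zero]
  · rw [Finset.mem_range] at hk
    by_cases hpk : p ∣ k + 1
    · rw [hcast, (CharP.cast_eq_zero_iff K p _).2 hpk, map_zero, mul_zero, PowerSeries.order_zero,
        ENat.mul_top hn', add_top]
      exact le_top
    · have hki : f.natDegree - (f.natDegree - (k + 1)) = k + 1 := by omega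
      have hi : f.natDegree - (k + 1) ∈
          (Finset.range f.natDegree).filter (fun i => ¬ p ∣ (f.natDegree - i)) :=
        Finset.mem_filter.2 ⟨Finset.mem_range.2 (by omega), by rwa [hki]⟩
      refine (Finset.inf_le hi).trans ?_
      rw [hki, Nat.add_sub_cancel, PowerSeries.order_mul]
      gcongr
      exact le_self_add
end

section
/- Let K be a complete discretely valued field, let L/K be a finite separable extension of degree n with discriminant exponent d_L, let E/K be an algebraic extension, and let l > d_L be an integer. If there exists a homomorphism of O_K-algebras from O_L to O_E/𝔪_E^{(l)} (reduction of O_E modulo the l-th power of the maximal ideal of O_K times O_E, i.e. modulo t^l), then there exists a K-embedding of L into E. -/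
open Polynomial

/-- A finite module over a Noetherian `I`-adically complete ring is `I`-adically complete. -/
theorem IsAdicComplete.of_finite {R : Type*} [CommRing R] [IsNoetherianRing R] (I : Ideal R)
    [IsAdicComplete I R] (M : Type*) [AddCommGroup M] [Module R M] [Module.Finite R M] :
    IsAdicComplete I M := by
  have : IsHausdorff I M := .of_le_jacobson I M (IsAdicComplete.le_jacobson_bot I)
  have : IsPrecomplete I M := by
    rw [← AdicCompletion.of_surjective_iff, ← LinearMap.range_eq_top, eq_top_iff]
    rintro y -
    obtain ⟨z, rfl⟩ := AdicCompletion.ofTensorProduct_surjective_of_finite I M y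
    induction z with
    | zero => simp
    | add a b ha hb => rw [map_add]; exact add_mem ha hb
    | tmul r m =>
      obtain ⟨a, rfl⟩ := AdicCompletion.of_surjective I R r
      refine ⟨a • m, ?_⟩
      rw [AdicCompletion.ofTensorProduct_tmul, map_smul]
      ext n
      rfl
  exact {}

/-- A ring that is finite over a Noetherian `I`-adically complete ring is adically complete for
the extended ideal. -/
theorem IsAdicComplete.map_algebraMap_of_finite {R : Type*} [CommRing R] [IsNoetherianRing R]
    (I : Ideal R) [IsAdicComplete I R] (S : Type*) [CommRing S] [Algebra R S]
    [Module.Finite R S] :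
    IsAdicComplete (I.map (algebraMap R S)) S :=
  (IsAdicComplete.map_algebraMap_iff I S).mpr (.of_finite I S)

/-- In an adically complete ring, `x = b + a * G(x)` is solvable for every polynomial `G`
and every topologically nilpotent `a`. -/
theorem IsAdicComplete.exists_eq_add_mul_eval {S : Type*} [CommRing S] (I : Ideal S)
    [IsAdicComplete I S] {a : S} (ha : a ∈ I) (b : S) (G : S[X]) :
    ∃ x, x = b + a * G.eval x := by
  let c : ℕ → S := fun n => Nat.rec b (fun _ x => b + a * G.eval x) n
  have hc : ∀ n, c (n + 1) = b + a * G.eval (c n) := fun _ => rfl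
  have hstep : ∀ n, c (n + 1) - c n ∈ I ^ n := by
    intro n
    induction n with
    | zero => simp
    | succ n ih =>
      obtain ⟨q, hq⟩ := sub_dvd_eval_sub (c (n + 1)) (c n) G
      have : c (n + 1 + 1) - c (n + 1) = (c (n + 1) - c n) * a * q := by
        rw [hc (n + 1), hc n] at *
        linear_combination a * hq
      rw [this, pow_succ]
      exact Ideal.mul_mem_right _ _ (Ideal.mul_mem_mul ih ha)
  have hcauchy : ∀ {m n}, m ≤ n → c m ≡ c n [SMOD (I ^ m • ⊤ : Ideal S)] := by
    intro m n hmn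
    rw [smul_eq_mul, Ideal.mul_top]
    induction n, hmn using Nat.le_induction with
    | base => rfl
    | succ n hmn ih =>
      refine ih.trans (SModEq.symm ?_)
      exact SModEq.sub_mem.mpr (Ideal.pow_le_pow_right hmn (hstep n))
  obtain ⟨x, hx⟩ := IsPrecomplete.prec' c hcauchy
  refine ⟨x, (IsHausdorff.eq_iff_smodEq (I := I)).mpr fun n => ?_⟩
  have h1 := hx n
  have h2 := hcauchy n.le_succ
  rw [Nat.succ_eq_add_one, hc] at h2
  rw [smul_eq_mul, Ideal.mul_top] at *
  exact h1.symm.trans (h2.trans (SModEq.rfl.add (SModEq.rfl.mul (h1.eval G))))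

/-- Hensel's lemma in Newton's form for a not necessarily monic polynomial over an adically
complete ring. -/
theorem IsAdicComplete.exists_isRoot_of_eval_eq {S : Type*} [CommRing S] (I : Ideal S)
    [IsAdicComplete I S] (P : S[X]) {b a : S} (ha : a ∈ I)
    (h : P.eval b = P.derivative.eval b ^ 2 * a) : ∃ y, P.IsRoot y := by
  set g := P.derivative.eval b with hg
  obtain ⟨R, hR⟩ := (P.map C).binomExpansion (C b) (C (a * g) * X)
  have hR' : ∀ w, P.eval (b + a * g * w) = P.eval b + g * (a * g * w)
      + R.eval w * (a * g * w) ^ 2 := by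
    intro w
    have hcomp : ∀ (p : S[X]) q, eval q (p.map C) = p.comp q := fun p q => eval_map C q
    rw [derivative_map, hcomp, hcomp, hcomp, comp_C, comp_C, ← hg] at hR
    simpa [eval_comp] using congrArg (eval w) hR
  obtain ⟨w, hw⟩ := IsAdicComplete.exists_eq_add_mul_eval I ha (-1) (-(R * X ^ 2))
  refine ⟨b + a * g * w, ?_⟩
  simp only [eval_neg, eval_mul, eval_pow, eval_X] at hw
  rw [IsRoot.def, hR', h]
  linear_combination g ^ 2 * a * hw

/-- An adically complete domain with Artinian residue ring is local. -/
theorem IsAdicComplete.isLocalRing_of_isDomain {S : Type*} [CommRing S] [IsDomain S] (I : Ideal S)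
    [IsAdicComplete I S] [IsArtinianRing (S ⧸ I)] : IsLocalRing S := by
  have hjac := IsAdicComplete.le_jacobson_bot I
  have hunit : ∀ z, 1 - z ∈ I → IsUnit z := fun z hz => by
    have := (Ideal.mem_jacobson_bot.mp (hjac hz)) (-1)
    simpa using this
  refine .of_isUnit_or_isUnit_one_sub_self fun x => ?_
  obtain ⟨n, y, hy⟩ :=
    IsArtinian.exists_pow_succ_smul_dvd (M := S ⧸ I) (Ideal.Quotient.mk I x) 1
  obtain ⟨y, rfl⟩ := Ideal.Quotient.mk_surjective y
  rw [smul_eq_mul, smul_eq_mul, mul_one, Nat.succ_eq_add_one] at hy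
  set N := n + 1
  have hstep : Ideal.Quotient.mk I (x ^ N * (x * y)) = Ideal.Quotient.mk I (x ^ N) := by
    simp only [map_mul, map_pow, N] at *
    linear_combination Ideal.Quotient.mk I x * hy
  have hpow : ∀ j, Ideal.Quotient.mk I (x ^ N * (x * y) ^ j) = Ideal.Quotient.mk I (x ^ N) := by
    intro j
    induction j with
    | zero => simp
    | succ j ih => rw [pow_succ, ← mul_assoc, mul_right_comm, map_mul, map_mul _ _ ((x * y) ^ j),
        ← hstep] at *; grind
  set e := (x * y) ^ N with he
  have hidem : e ^ 2 - e ∈ I := by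
    rw [← Ideal.Quotient.mk_eq_mk_iff_sub_mem]
    have h1 : e ^ 2 = x ^ N * (x * y) ^ N * y ^ N := by rw [he]; ring
    have h2 : e = x ^ N * y ^ N := by rw [he]; ring
    rw [h1, map_mul, hpow, ← map_mul, ← h2]
  obtain ⟨a, ha, hae⟩ := HenselianRing.is_henselian (I := I) (X ^ 2 - X : S[X])
    (by monicity!) e (by simpa using hidem) (by
      refine IsUnit.map (Ideal.Quotient.mk I) ?_
      have : IsUnit ((2 * e - 1) ^ 2) := by
        refine hunit _ ?_
        convert I.mul_mem_left (-4) hidem using 1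
        ring
      simpa [one_add_one_eq_two] using (isUnit_pow_iff two_ne_zero).mp this)
  have ha' : a * (a - 1) = 0 := by
    simp at ha
    linear_combination ha
  rcases mul_eq_zero.mp ha' with h0 | h1
  · right
    have hxN : x ^ N ∈ I := by
      rw [← Ideal.Quotient.eq_zero_iff_mem, ← hpow N, Ideal.Quotient.eq_zero_iff_mem]
      refine I.mul_mem_left _ ?_
      simpa [h0] using hae
    refine isUnit_of_dvd_unit ?_ (hunit (1 - x ^ N) (by simpa using hxN))
    simpa using sub_dvd_pow_sub_pow 1 x N
  · left
    have : IsUnit e := hunit e (by rwa [sub_eq_zero.mp h1] at hae)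
    exact isUnit_of_mul_isUnit_left ((isUnit_pow_iff n.succ_ne_zero).mp this)

/-- A domain that is finite over a complete Noetherian local ring is local. -/
theorem IsLocalRing.of_finite_of_isAdicComplete (R : Type*) [CommRing R] [IsNoetherianRing R]
    [IsLocalRing R] [IsAdicComplete (IsLocalRing.maximalIdeal R) R] (S : Type*) [CommRing S]
    [IsDomain S] [Algebra R S] [Module.Finite R S] : IsLocalRing S := by
  let m := IsLocalRing.maximalIdeal R
  have := IsAdicComplete.map_algebraMap_of_finite m S
  let : Field (R ⧸ m) := Ideal.Quotient.field m
  have : Module.Finite (R ⧸ m) (S ⧸ m.map (algebraMap R S)) :=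
    Module.Finite.of_restrictScalars_finite R _ _
  have : IsArtinianRing (S ⧸ m.map (algebraMap R S)) := .of_finite (R ⧸ m) _
  exact IsAdicComplete.isLocalRing_of_isDomain (m.map (algebraMap R S))

/-- In a valuation ring that is finite free of rank `n` over a domain, `x ^ n` divides the norm
of `x`. -/
theorem ValuationRing.pow_finrank_dvd_norm (R : Type*) [CommRing R] [IsDomain R] {S : Type*}
    [CommRing S] [IsDomain S] [ValuationRing S] [Algebra R S] [Module.Free R S]
    [Module.Finite R S] (x : S) :
    x ^ Module.finrank R S ∣ algebraMap R S (Algebra.norm R x) := by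
  rcases ValuationRing.dvd_total (x ^ Module.finrank R S) (algebraMap R S (Algebra.norm R x))
    with h | ⟨y, hy⟩
  · exact h
  · rcases eq_or_ne x 0 with rfl | hx
    · simp [Algebra.norm_zero]
    have hN : Algebra.norm R x ≠ 0 := Algebra.norm_ne_zero_iff.mpr hx
    have hy1 : Algebra.norm R y = 1 := by
      have := congrArg (Algebra.norm R) hy
      rw [map_pow, map_mul, Algebra.norm_algebraMap] at this
      exact mul_left_cancel₀ (pow_ne_zero _ hN) (by rw [mul_one, ← this])
    have hyu : IsUnit y := by
      have := (LinearMap.isUnit_iff_isUnit_det (Algebra.lmul R S y)).mpr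
        (by rw [← Algebra.norm_apply, hy1]; exact isUnit_one)
      obtain ⟨z, hz⟩ := ((Module.End.isUnit_iff _).mp this).2 1
      exact .of_mul_eq_one z hz
    rw [hy, hyu.mul_right_dvd]

open scoped nonZeroDivisors in
/-- A power basis of a ring extension induces one of the extension of fraction fields. -/
noncomputable def PowerBasis.fractionField {A : Type*} (K L : Type*) {S : Type*} [CommRing A]
    [Field K] [Field L] [CommRing S] [Algebra A K] [IsFractionRing A K] [Algebra A S] [Algebra S L]
    [Algebra K L] [Algebra A L] [IsScalarTower A K L] [IsScalarTower A S L]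
    [IsLocalization (Algebra.algebraMapSubmonoid S A⁰) L] (pb : PowerBasis A S) :
    PowerBasis K L where
  gen := algebraMap S L pb.gen
  dim := pb.dim
  basis := pb.basis.localizationLocalization K A⁰ L
  basis_eq_pow i := by simp [Module.Basis.localizationLocalization_apply]

open scoped nonZeroDivisors in
/-- The discriminant of a power basis is, up to sign, the norm of the derivative of the minimal
polynomial of the generator at the generator. -/
theorem Algebra.discr_powerBasis_eq_norm_of_isIntegrallyClosed {A : Type*} (K L : Type*)
    {S : Type*} [CommRing A] [IsDomain A] [IsIntegrallyClosed A] [Field K] [Field L] [CommRing S]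
    [IsDomain S] [Algebra A K] [IsFractionRing A K] [Algebra A S] [Module.IsTorsionFree A S]
    [Algebra S L] [Algebra K L] [Algebra A L]
    [IsScalarTower A K L] [IsScalarTower A S L] [FaithfulSMul S L]
    [IsLocalization (Algebra.algebraMapSubmonoid S A⁰) L] [Algebra.IsSeparable K L]
    (pb : PowerBasis A S) :
    ∃ m : ℕ, Algebra.discr A pb.basis =
      (-1) ^ m * Algebra.norm A (aeval pb.gen (minpoly A pb.gen).derivative) := by
  have : Module.Finite A S := pb.finite
  have : Module.Free A S := .of_basis pb.basis
  let pbK := pb.fractionField K L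
  have : FiniteDimensional K L := pbK.finite
  refine ⟨Module.finrank K L * (Module.finrank K L - 1) / 2, IsFractionRing.injective A K ?_⟩
  have h := Algebra.discr_powerBasis_eq_norm K pbK
  have hmin : minpoly K pbK.gen = (minpoly A pb.gen).map (algebraMap A K) :=
    minpoly.isIntegrallyClosed_eq_field_fractions K L pb.isIntegral_gen
  rw [hmin, derivative_map, aeval_map_algebraMap,
    show pbK.gen = algebraMap S L pb.gen from rfl, aeval_algebraMap_apply,
    Algebra.norm_localization A A⁰] at h
  rw [← Algebra.discr_localizationLocalization A A⁰ L pb.basis, map_mul, map_pow, map_neg, map_one]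
  exact h

open scoped nonZeroDivisors in
/-- If the extension of fraction fields is separable and the extension ring is a valuation ring,
then the square of the derivative of the minimal polynomial of the generator, evaluated at the
generator, divides the discriminant of the power basis. -/
theorem PowerBasis.sq_aeval_derivative_minpoly_dvd_discr {A : Type*} (K L : Type*)
    {S : Type*} [CommRing A] [IsDomain A] [IsIntegrallyClosed A] [Field K] [Field L] [CommRing S]
    [IsDomain S] [ValuationRing S] [Algebra A K] [IsFractionRing A K] [Algebra A S]
    [Module.IsTorsionFree A S] [Algebra S L] [Algebra K L] [Algebra A L]
    [IsScalarTower A K L] [IsScalarTower A S L] [FaithfulSMul S L]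
    [IsLocalization (Algebra.algebraMapSubmonoid S A⁰) L] [Algebra.IsSeparable K L]
    (pb : PowerBasis A S) :
    aeval pb.gen (minpoly A pb.gen).derivative ^ 2 ∣
      algebraMap A S (Algebra.discr A pb.basis) := by
  have : Module.Finite A S := pb.finite
  have : Module.Free A S := .of_basis pb.basis
  rcases Nat.lt_or_ge (Module.finrank A S) 2 with h | h
  · have hdeg : (minpoly A pb.gen).natDegree = 1 := by
      have h0 : 0 < Module.finrank A S := Module.finrank_pos
      have h1 := pb.natDegree_minpoly
      have h2 := pb.finrank
      omega
    have hmonic := minpoly.monic pb.isIntegral_gen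
    rw [hmonic.eq_X_add_C hdeg]
    simp
  · obtain ⟨m, hm⟩ := Algebra.discr_powerBasis_eq_norm_of_isIntegrallyClosed K L pb
    rw [hm, map_mul]
    exact ((pow_dvd_pow _ h).trans (ValuationRing.pow_finrank_dvd_norm A _)).mul_left _

/-- Over an `I`-adically complete Noetherian ring `A` with `ϖ ∈ I`, if `f` at `b` is divisible by
`c * ϖ` and the square of its derivative at `b` divides `c` up to a multiple of `c * ϖ`, then `f`
has a root in the given integral extension of `A`. -/
theorem Algebra.IsIntegral.exists_aeval_eq_zero {A : Type*} [CommRing A] [IsNoetherianRing A]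
    (I : Ideal A) [IsAdicComplete I A] {B : Type*} [CommRing B] [Algebra A B]
    [Algebra.IsIntegral A B] (f : A[X]) {ϖ c : A} (hϖ : ϖ ∈ I) {b u v g : B}
    (hb : aeval b f = algebraMap A B (c * ϖ) * u)
    (hg : aeval b f.derivative ^ 2 * g = algebraMap A B c + algebraMap A B (c * ϖ) * v) :
    ∃ y : B, aeval y f = 0 := by
  obtain ⟨S, hfin, hb_mem, hu_mem, hv_mem, hg_mem⟩ :
      ∃ S : Subalgebra A B, Module.Finite A S ∧ b ∈ S ∧ u ∈ S ∧ v ∈ S ∧ g ∈ S := by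
    refine ⟨Algebra.adjoin A {b, u, v, g}, Module.Finite.iff_fg.mpr
      (fg_adjoin_of_finite (Set.toFinite _) fun x _ => Algebra.IsIntegral.isIntegral x), ?_⟩
    refine ⟨?_, ?_, ?_, ?_⟩ <;> exact Algebra.subset_adjoin (by simp)
  let J := I.map (algebraMap A S)
  have : IsAdicComplete J S := .map_algebraMap_of_finite I S
  have hϖJ : algebraMap A S ϖ ∈ J := Ideal.mem_map_of_mem _ hϖ
  lift b to S using hb_mem
  lift u to S using hu_mem
  lift v to S using hv_mem
  lift g to S using hg_mem
  have hb' : aeval b f = algebraMap A S (c * ϖ) * u := Subtype.ext (by simpa using hb)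
  have hg' : aeval b f.derivative ^ 2 * g = algebraMap A S c * (1 + algebraMap A S ϖ * v) := by
    refine Subtype.ext ?_
    simp at hg ⊢
    linear_combination hg
  have hu : IsUnit (1 + algebraMap A S ϖ * v) := by
    rw [add_comm]
    exact Ideal.mem_jacobson_bot.mp (IsAdicComplete.le_jacobson_bot J hϖJ) v
  obtain ⟨w, hw⟩ := hu.exists_right_inv
  obtain ⟨y, hy⟩ := IsAdicComplete.exists_isRoot_of_eval_eq J (f.map (algebraMap A S)) (b := b)
    (a := algebraMap A S ϖ * (g * w * u)) (J.mul_mem_right _ hϖJ) (by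
      rw [derivative_map, eval_map_algebraMap, eval_map_algebraMap, hb', map_mul]
      linear_combination (-algebraMap A S ϖ * w * u) * hg' -
        algebraMap A S c * algebraMap A S ϖ * u * hw)
  refine ⟨y, ?_⟩
  rw [IsRoot.def, eval_map_algebraMap] at hy
  rw [← Subalgebra.coe_val, aeval_algHom_apply, hy, map_zero]

/-- Over an `I`-adically complete Noetherian ring `A` with `ϖ ∈ I`, let `α` be a root of `f` in an
`A`-algebra `S`, such that the square of the derivative of `f` at `α` divides a scalar `c`. If `S`
maps to the quotient of an integral extension `B` by `c * ϖ`, then `f` has a root in `B`. -/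
theorem AlgHom.exists_aeval_eq_zero_of_quotient {A : Type*} [CommRing A] [IsNoetherianRing A]
    (I : Ideal A) [IsAdicComplete I A] {S B : Type*} [CommRing S] [Algebra A S] [CommRing B]
    [Algebra A B] [Algebra.IsIntegral A B] {f : A[X]} {α : S} (hα : aeval α f = 0) {ϖ c : A}
    (hϖ : ϖ ∈ I) (hc : aeval α f.derivative ^ 2 ∣ algebraMap A S c)
    (φ : S →ₐ[A] B ⧸ Ideal.span {algebraMap A B (c * ϖ)}) :
    ∃ y : B, aeval y f = 0 := by
  obtain ⟨γ, hγ⟩ := hc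
  obtain ⟨b, hb⟩ := Ideal.Quotient.mkₐ_surjective A _ (φ α)
  obtain ⟨g, hg⟩ := Ideal.Quotient.mkₐ_surjective A _ (φ γ)
  have hmk : ∀ p : A[X], Ideal.Quotient.mkₐ A _ (aeval b p) = φ (aeval α p) := fun p => by
    rw [← aeval_algHom_apply, ← aeval_algHom_apply, hb]
  obtain ⟨u, hu⟩ : algebraMap A B (c * ϖ) ∣ aeval b f := by
    rw [← Ideal.mem_span_singleton, ← Ideal.Quotient.eq_zero_iff_mem,
      ← Ideal.Quotient.mkₐ_eq_mk A, hmk, hα, map_zero]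
  obtain ⟨v, hv⟩ : algebraMap A B (c * ϖ) ∣ aeval b f.derivative ^ 2 * g - algebraMap A B c := by
    rw [← Ideal.mem_span_singleton, ← Ideal.Quotient.eq_zero_iff_mem,
      ← Ideal.Quotient.mkₐ_eq_mk A, map_sub, map_mul (Ideal.Quotient.mkₐ A _), map_pow, hmk, hg,
      ← map_pow, ← map_mul, ← hγ, AlgHom.commutes, AlgHom.commutes, sub_self]
  exact Algebra.IsIntegral.exists_aeval_eq_zero I f hϖ hu (sub_eq_iff_eq_add'.mp hv)

/-- Over a field, a power series of order less than `l` divides `X ^ l`, with quotient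
divisible by `X`. -/
theorem PowerSeries.exists_mul_eq_X_pow_of_order_lt {k : Type*} [Field k] {D : PowerSeries k}
    {l : ℕ} (hD : D.order < l) :
    ∃ ϖ ∈ Ideal.span {(PowerSeries.X : PowerSeries k)}, D * ϖ = PowerSeries.X ^ l := by
  have hD0 : D ≠ 0 := by
    rintro rfl
    simp at hD
  obtain ⟨d, hd⟩ := ENat.ne_top_iff_exists.mp (order_eq_top.not.mpr hD0)
  rw [← hd, Nat.cast_lt] at hD
  obtain ⟨e, he⟩ := (isUnit_divided_by_X_pow_order hD0).exists_right_inv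
  refine ⟨X ^ (l - d) * e, Ideal.mul_mem_right _ _ (Ideal.pow_mem_of_mem _
    (Ideal.mem_span_singleton_self _) _ (Nat.sub_pos_of_lt hD)), ?_⟩
  have hfac : X ^ d * divXPowOrder D = D := by
    simpa [← hd] using X_pow_order_mul_divXPowOrder (f := D)
  rw [← Nat.add_sub_of_le hD.le, pow_add, Nat.add_sub_cancel_left]
  linear_combination (-X ^ (l - d) * e) * hfac + X ^ d * X ^ (l - d) * he


/-- (Variant of a lemma of Fontaine.) Let `K = k((t))`, let `L/K` be a finite separable
extension with ring of integers `O_L = k⟦t⟧[α]` (a power basis `pb`), with discriminant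
exponent `d_L` = `t`-adic order of the discriminant of `pb`, and let `E/K` be an
algebraic extension with ring of integers `O_E`. If `l > d_L` and there exists a
`k⟦t⟧`-algebra homomorphism `O_L → O_E/(tˡ)`, then there is a `K`-embedding `L → E`. -/
theorem stmt_7 (k : Type*) [Field k] (L E : Type*) [Field L] [Field E]
    [Algebra (LaurentSeries k) L] [FiniteDimensional (LaurentSeries k) L]
    [Algebra.IsSeparable (LaurentSeries k) L]
    [Algebra (LaurentSeries k) E] [Algebra.IsAlgebraic (LaurentSeries k) E]
    [Algebra (PowerSeries k) L] [IsScalarTower (PowerSeries k) (LaurentSeries k) L]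
    [Algebra (PowerSeries k) E] [IsScalarTower (PowerSeries k) (LaurentSeries k) E]
    (pb : PowerBasis (PowerSeries k) (integralClosure (PowerSeries k) L))
    (l : ℕ)
    (hl : (Algebra.discr (PowerSeries k) pb.basis).order < (l : ℕ∞))
    (h : Nonempty (integralClosure (PowerSeries k) L →ₐ[PowerSeries k]
      (integralClosure (PowerSeries k) E ⧸
        Ideal.span {algebraMap (PowerSeries k) (integralClosure (PowerSeries k) E)
          (PowerSeries.X ^ l)}))) :
    Nonempty (L →ₐ[LaurentSeries k] E) := by
  let A := PowerSeries k
  let K := LaurentSeries k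
  let S := integralClosure A L
  obtain ⟨φ⟩ := h
  have : Module.Finite A S := pb.finite
  have : FaithfulSMul A L := .trans A K L
  have : Module.IsTorsionFree A S := inferInstance
  have : IsLocalization (Algebra.algebraMapSubmonoid S (nonZeroDivisors A)) L :=
    IsIntegralClosure.isLocalization A K L S
  have : IsLocalRing S := by
    have : IsAdicComplete (IsLocalRing.maximalIdeal A) A := by
      rw [PowerSeries.maximalIdeal_eq_span_X]
      infer_instance
    exact .of_finite_of_isAdicComplete A S
  have : IsDedekindDomain S := integralClosure.isDedekindDomain A K L
  have : ValuationRing S :=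
    ((tfae_of_isNoetherianRing_of_isLocalRing_of_isDomain S).out 2 1).mp this
  obtain ⟨ϖ, hϖ, hDϖ⟩ := PowerSeries.exists_mul_eq_X_pow_of_order_lt hl
  rw [← hDϖ] at φ
  obtain ⟨y, hy⟩ := φ.exists_aeval_eq_zero_of_quotient (Ideal.span {PowerSeries.X})
    (minpoly.aeval A pb.gen) hϖ (pb.sq_aeval_derivative_minpoly_dvd_discr K L)
  let pbK := pb.fractionField K L
  refine ⟨pbK.lift (y : E) ?_⟩
  have hmin : minpoly K pbK.gen = (minpoly A pb.gen).map (algebraMap A K) :=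
    minpoly.isIntegrallyClosed_eq_field_fractions K L pb.isIntegral_gen
  rw [hmin, aeval_map_algebraMap, ← Subalgebra.coe_val, aeval_algHom_apply, hy, map_zero]
end

section
/- Let K be a complete discretely valued field and let L and L' be finite separable field extensions of K of the same degree. If for some integer l greater than the discriminant exponent of L/K there exists an O_K-algebra isomorphism O_L/t^l·O_L ≅ O_{L'}/t^l·O_{L'}, then L and L' are isomorphic as K-algebras. -/
theorem Ideal.mem_span_singleton_pow_smul_top_iff {A M : Type*} [CommRing A] [AddCommGroup M]
    [Module A M] {a : A} {n : ℕ} {x : M} :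
    x ∈ (Ideal.span {a} ^ n • ⊤ : Submodule A M) ↔ ∃ y : M, a ^ n • y = x := by
  rw [Ideal.span_singleton_pow, Submodule.ideal_span_singleton_smul,
    Submodule.mem_smul_pointwise_iff_exists]
  simp

/-- A finite free module over an `a`-adically complete ring is `a`-adically complete. -/
theorem IsAdicComplete.of_finite_free {A M : Type*} [CommRing A] [AddCommGroup M] [Module A M]
    [Module.Free A M] [Module.Finite A M] (a : A) [IsAdicComplete (Ideal.span {a}) A] :
    IsAdicComplete (Ideal.span {a}) M := by
  let b := Module.Free.chooseBasis A M
  have key : ∀ (n : ℕ) (x y : M), x ≡ y [SMOD (Ideal.span {a} ^ n • ⊤ : Submodule A M)] ↔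
      ∀ i, b.repr x i ≡ b.repr y i [SMOD (Ideal.span {a} ^ n • ⊤ : Submodule A A)] := by
    intro n x y
    simp only [SModEq.sub_mem, Ideal.mem_span_singleton_pow_smul_top_iff]
    constructor
    · rintro ⟨z, hz⟩ i
      exact ⟨b.repr z i, by rw [← Finsupp.sub_apply, ← map_sub, ← hz]; simp⟩
    · intro h
      choose z hz using h
      refine ⟨b.equivFun.symm z, b.equivFun.injective ?_⟩
      ext i
      rw [map_smul, Pi.smul_apply, b.equivFun.apply_symm_apply, hz i]
      simp
  refine { haus' := fun x hx => ?_, prec' := fun f hf => ?_ }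
  · refine b.repr.injective (Finsupp.ext fun i => ?_)
    rw [map_zero, Finsupp.zero_apply]
    refine IsHausdorff.haus (I := Ideal.span {a}) inferInstance _ fun n => ?_
    simpa using (key n x 0).1 (hx n) i
  · choose L hL using fun i => IsPrecomplete.prec (I := Ideal.span {a}) (M := A) inferInstance
      (f := fun n => b.repr (f n) i) fun {m n} hmn => (key m _ _).1 (hf hmn) i
    refine ⟨b.equivFun.symm L, fun n => (key n _ _).2 fun i => ?_⟩
    have : b.repr (b.equivFun.symm L) i = L i := congrFun (b.equivFun.apply_symm_apply L) i
    rw [this]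
    exact hL i n

theorem IsAdicComplete.span_algebraMap_of_finite_free {A : Type*} (R : Type*) [CommRing A]
    [CommRing R] [Algebra A R] [Module.Free A R] [Module.Finite A R] (a : A)
    [IsAdicComplete (Ideal.span {a}) A] : IsAdicComplete (Ideal.span {algebraMap A R a}) R := by
  rw [← Set.image_singleton, ← Ideal.map_span, IsAdicComplete.map_algebraMap_iff]
  exact .of_finite_free a

open Polynomial in
/-- Hensel's lemma for a root which need not be simple modulo `I`. -/
theorem HenselianRing.exists_isRoot_of_eval_eq_sq_mul {R : Type*} [CommRing R] {I : Ideal R}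
    [HenselianRing R I] {f : R[X]} (hdeg : 2 ≤ f.natDegree) {b e : R} (he : e ∈ I)
    (hb : f.eval b = f.derivative.eval b ^ 2 * e) : ∃ c, f.IsRoot c := by
  nontriviality R
  set s := f.derivative.eval b with hs
  set n := f.natDegree with hn
  set T := taylor b f with hT
  let Q : R[X] :=
    ∑ i ∈ Finset.Ico 2 (n + 1), C (T.coeff i * s ^ (i - 2) * e ^ (i - 2)) * X ^ (n - i)
  have hQ : (X ^ (n - 1) + C e * Q).degree < (n : WithBot ℕ) := by
    have h1 : (X ^ (n - 1) : R[X]).degree < (n : WithBot ℕ) := by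
      rw [degree_X_pow]; exact_mod_cast (by omega : n - 1 < n)
    have h2 : (C e * Q).degree < (n : WithBot ℕ) := by
      rw [← smul_eq_C_mul]
      refine lt_of_le_of_lt (degree_smul_le _ _) ?_
      refine mem_degreeLT.1 (Submodule.sum_mem (degreeLT R n) fun i hi => mem_degreeLT.2 ?_)
      rw [Finset.mem_Ico] at hi
      refine lt_of_le_of_lt (degree_C_mul_X_pow_le _ _) ?_
      exact_mod_cast (by omega : n - i < n)
    exact lt_of_le_of_lt (degree_add_le _ _) (max_lt h1 h2)
  let P : R[X] := X ^ n + (X ^ (n - 1) + C e * Q)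
  obtain ⟨m, hm⟩ : ∃ m, n = m + 2 := ⟨n - 2, by omega⟩
  obtain ⟨u, hu, hu1⟩ := HenselianRing.is_henselian (I := I) P (monic_X_pow_add hQ) (-1)
    (by
      have : P.eval (-1) = e * Q.eval (-1) := by
        simp only [P, hm, eval_add, eval_mul, eval_pow, eval_X, eval_C]
        rw [show m + 2 - 1 = m + 1 by omega]; ring
      rw [this]
      exact I.mul_mem_right _ he)
    (by
      have : P.derivative.eval (-1) = (-1) ^ (m + 1) + e * Q.derivative.eval (-1) := by
        simp only [P, hm, derivative_add, derivative_mul, derivative_C, derivative_X_pow, eval_add,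
          eval_mul, eval_pow, eval_X, eval_C]
        rw [show m + 2 - 1 = m + 1 by omega, show m + 1 - 1 = m by omega]
        simp
        ring
      rw [this, map_add, Ideal.Quotient.eq_zero_iff_mem.2 (I.mul_mem_right _ he), add_zero]
      exact ((isUnit_one.neg).pow _).map _)
  have hunit : IsUnit u := by
    have := isLocalHom_of_le_jacobson_bot I HenselianRing.jac
    refine isUnit_of_map_unit (Ideal.Quotient.mk I) u ?_
    rw [Ideal.Quotient.eq.2 hu1]
    exact (isUnit_one.neg).map _
  obtain ⟨v, hv⟩ := hunit.exists_right_inv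
  refine ⟨b + s * (e * v), ?_⟩
  have hT0 : T.coeff 0 = s ^ 2 * e := by rw [hT, taylor_coeff_zero, hb]
  have hT1 : T.coeff 1 = s := by rw [hT, taylor_coeff_one]
  have huv : ∀ i ≤ n, v ^ n * u ^ (n - i) = v ^ i := by
    intro i hi
    obtain ⟨j, hj⟩ := Nat.exists_eq_add_of_le hi
    rw [hj, Nat.add_sub_cancel_left, pow_add, mul_assoc, ← mul_pow, mul_comm v u, hv, one_pow,
      mul_one]
  have hPu : v ^ n * P.eval u = 1 + v + e *
      ∑ i ∈ Finset.Ico 2 (n + 1), T.coeff i * s ^ (i - 2) * e ^ (i - 2) * v ^ i := by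
    simp only [P, Q, eval_add, eval_mul, eval_pow, eval_X, eval_C, eval_finsetSum]
    rw [mul_add, mul_add, huv 1 (by omega), pow_one, ← add_assoc]
    congr 1
    · have := huv 0 (Nat.zero_le _)
      simp only [Nat.sub_zero, pow_zero] at this
      rw [this]
    · rw [Finset.mul_sum, Finset.mul_sum, Finset.mul_sum]
      refine Finset.sum_congr rfl fun i hi => ?_
      rw [Finset.mem_Ico] at hi
      rw [← huv i (by omega)]
      ring
  have hTe : f.eval (b + s * (e * v)) = T.eval (s * (e * v)) := by
    rw [hT, taylor_eval, add_comm]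
  rw [IsRoot.def, hTe, eval_eq_sum_range, hT, natDegree_taylor, ← hT, ← hn,
    ← Finset.sum_range_add_sum_Ico _ (by omega : 2 ≤ n + 1), Finset.sum_range_succ,
    Finset.sum_range_one, hT0, hT1]
  have : ∑ i ∈ Finset.Ico 2 (n + 1), T.coeff i * (s * (e * v)) ^ i = s ^ 2 * e * (e *
      ∑ i ∈ Finset.Ico 2 (n + 1), T.coeff i * s ^ (i - 2) * e ^ (i - 2) * v ^ i) := by
    rw [Finset.mul_sum, Finset.mul_sum]
    refine Finset.sum_congr rfl fun i hi => ?_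
    obtain ⟨j, rfl⟩ := Nat.exists_eq_add_of_le (Finset.mem_Ico.1 hi).1
    rw [Nat.add_sub_cancel_left]
    ring
  rw [this]
  have h0 : s ^ 2 * e * (v ^ n * P.eval u) = 0 := by rw [hu.eq_zero]; ring
  rw [hPu] at h0
  linear_combination h0

open Polynomial in
/-- A Dedekind domain which is Henselian at a nonzero principal ideal is local. -/
theorem IsLocalRing.of_isDedekindDomain_of_henselianRing {R : Type*} [CommRing R]
    [IsDedekindDomain R] {t : R} (ht : t ≠ 0) [HenselianRing R (Ideal.span {t})] :
    IsLocalRing R := by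
  obtain ⟨M, hM⟩ := Ideal.exists_maximal R
  refine IsLocalRing.of_unique_max_ideal ⟨M, hM, fun N hN => ?_⟩
  by_contra hne
  have hmem : ∀ P : Ideal R, P.IsMaximal → t ∈ P := fun P hP =>
    Ideal.mem_sInf.1 (HenselianRing.jac (Ideal.mem_span_singleton_self t)) ⟨bot_le, hP⟩
  have hfin : FiniteMultiplicity M (Ideal.span {t}) :=
    FiniteMultiplicity.of_not_isUnit (fun h => hM.ne_top (Ideal.isUnit_iff.1 h))
      (by simpa using ht)
  obtain ⟨J, hJ, hMJ⟩ := hfin.exists_eq_pow_mul_and_not_dvd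
  set a := multiplicity M (Ideal.span {t})
  have hdvd : M ∣ Ideal.span {t} := by
    rw [Ideal.dvd_span_singleton]; exact hmem M hM
  have ha0 : a ≠ 0 := fun h => hMJ (by rw [h, pow_zero, one_mul] at hJ; rwa [← hJ])
  have hJN : J ≤ N := by
    have : M ^ a * J ≤ N := by
      rw [← hJ, Ideal.span_singleton_le_iff_mem]; exact hmem N hN
    rcases hN.isPrime.mul_le.1 this with h | h
    · exact absurd (hM.eq_of_le hN.ne_top (hN.isPrime.le_of_pow_le h)) (Ne.symm hne)
    · exact h
  have hcop : IsCoprime (M ^ a) J := by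
    refine IsCoprime.pow_left ?_
    rw [Ideal.isCoprime_iff_sup_eq]
    exact hM.1.2 _ (left_lt_sup.2 fun h => hMJ (Ideal.dvd_iff_le.2 h))
  obtain ⟨e, he, f, hf, hef⟩ := Ideal.isCoprime_iff_exists.1 hcop
  have heM : e ∈ M := Ideal.pow_le_self ha0 he
  have hprod : e * f ∈ Ideal.span {t} := hJ ▸ Ideal.mul_mem_mul he hf
  obtain ⟨r, hr, hre⟩ := HenselianRing.is_henselian (I := Ideal.span {t}) (X ^ 2 - X : R[X])
    (monic_X_pow_sub (by rw [degree_X]; norm_num)) e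
    (by
      have : (X ^ 2 - X : R[X]).eval e = -(e * f) := by
        simp only [eval_sub, eval_pow, eval_X]
        linear_combination e * hef
      rw [this]
      exact neg_mem hprod)
    (by
      refine IsUnit.of_mul_eq_one (Ideal.Quotient.mk _ (2 * e - 1)) ?_
      rw [← map_mul, ← map_one (Ideal.Quotient.mk _), Ideal.Quotient.eq]
      have : (X ^ 2 - X : R[X]).derivative.eval e * (2 * e - 1) - 1 = -4 * (e * f) := by
        simp only [derivative_sub, derivative_X_pow, derivative_X, eval_sub, eval_mul, eval_pow,
          eval_X, eval_C, eval_one]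
        push_cast
        linear_combination 4 * e * hef
      rw [this]
      exact Ideal.mul_mem_left _ _ hprod)
  have hr' : r * (r - 1) = 0 := by
    have := hr.eq_zero
    simp only [eval_sub, eval_pow, eval_X] at this
    linear_combination this
  rcases mul_eq_zero.1 hr' with h | h
  · refine hN.ne_top ((Ideal.eq_top_iff_one _).2 (hef ▸ N.add_mem ?_ (hJN hf)))
    have : r - e ∈ N := (Ideal.span_singleton_le_iff_mem _).2 (hmem N hN) hre
    simpa [h] using this
  · refine hM.ne_top ((Ideal.eq_top_iff_one _).2 ?_)
    have : r - e ∈ M := (Ideal.span_singleton_le_iff_mem _).2 (hmem M hM) hre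
    have h1 : r = 1 := sub_eq_zero.1 h
    simpa [h1] using M.add_mem this heM

theorem IsDiscreteValuationRing.of_isDedekindDomain_of_henselianRing {R : Type*} [CommRing R]
    [IsDedekindDomain R] {t : R} (ht : t ≠ 0) [HenselianRing R (Ideal.span {t})] :
    IsDiscreteValuationRing R := by
  have := IsLocalRing.of_isDedekindDomain_of_henselianRing ht
  have hfield : ¬ IsField R := fun hfield => by
    obtain ⟨y, hy⟩ := hfield.mul_inv_cancel ht
    have := Ideal.mem_jacobson_bot.1 (HenselianRing.jac (Ideal.mem_span_singleton_self t)) (-y)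
    rw [mul_neg, hy, neg_add_cancel] at this
    exact not_isUnit_zero this
  have h : IsDedekindDomain R ↔ IsDiscreteValuationRing R :=
    (IsDiscreteValuationRing.TFAE R hfield).out 2 0
  exact h.1 inferInstance

/-- In a discrete valuation ring finite free of rank at least two over `A`, the square of an element
divides its norm. -/
theorem IsDiscreteValuationRing.sq_dvd_algebraMap_of_associated_norm {A R : Type*} [CommRing A]
    [IsDomain A] [CommRing R] [IsDomain R] [IsDiscreteValuationRing R] [Algebra A R]
    [Module.Free A R] [Module.Finite A R] (hrank : 2 ≤ Module.finrank A R) {t : A} (ht : Prime t)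
    {y : R} {d : ℕ} (hy : Associated (Algebra.norm A y) (t ^ d)) :
    y ^ 2 ∣ algebraMap A R (t ^ d) := by
  obtain ⟨ϖ, hϖ⟩ := IsDiscreteValuationRing.exists_irreducible R
  have ht0 : algebraMap A R t ≠ 0 :=
    (map_ne_zero_iff _ (FaithfulSMul.algebraMap_injective A R)).2 ht.ne_zero
  have hy0 : y ≠ 0 := by
    rintro rfl
    have : Module.finrank A R ≠ 0 := by omega
    rw [show (0 : R) = algebraMap A R 0 by simp, Algebra.norm_algebraMap, zero_pow this,
      Associated.comm, associated_zero_iff_eq_zero] at hy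
    exact pow_ne_zero _ ht.ne_zero hy
  obtain ⟨e, he⟩ := IsDiscreteValuationRing.associated_pow_irreducible ht0 hϖ
  obtain ⟨m, hm⟩ := IsDiscreteValuationRing.associated_pow_irreducible hy0 hϖ
  have h1 : Associated (y ^ e) (algebraMap A R t ^ m) := by
    refine (hm.pow_pow (n := e)).trans ?_
    rw [← pow_mul, mul_comm, pow_mul]
    exact (he.pow_pow (n := m)).symm
  have h2 : Associated (t ^ (d * e)) (t ^ (Module.finrank A R * m)) := by
    have := h1.map (Algebra.norm A)
    rw [map_pow, map_pow, Algebra.norm_algebraMap, ← pow_mul] at this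
    rw [pow_mul]
    exact (hy.pow_pow (n := e)).symm.trans this
  have h3 : d * e = Module.finrank A R * m :=
    le_antisymm ((pow_dvd_pow_iff ht.ne_zero ht.not_isUnit).1 h2.dvd)
      ((pow_dvd_pow_iff ht.ne_zero ht.not_isUnit).1 h2.symm.dvd)
  rw [map_pow]
  refine (hm.pow_pow (n := 2)).dvd.trans (Dvd.dvd.trans ?_ (he.pow_pow (n := d)).symm.dvd)
  rw [← pow_mul, ← pow_mul]
  refine pow_dvd_pow _ ?_
  rw [mul_comm e d, h3, mul_comm m 2]
  exact Nat.mul_le_mul_right _ hrank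

/-- The power basis of `L / K` induced by an integral power basis. -/
noncomputable def PowerBasis.localizationLocalization {A R : Type*} (K L : Type*) [CommRing A]
    [CommRing R] [Algebra A R] [Field K] [Field L] [Algebra A K] [Algebra R L]
    [Algebra K L] [Algebra A L] [IsScalarTower A K L] [IsScalarTower A R L] [IsFractionRing A K]
    [IsLocalization (Algebra.algebraMapSubmonoid R (nonZeroDivisors A)) L] (pb : PowerBasis A R) :
    PowerBasis K L where
  gen := algebraMap R L pb.gen
  dim := pb.dim
  basis := pb.basis.localizationLocalization K (nonZeroDivisors A) L
  basis_eq_pow i := by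
    rw [Module.Basis.localizationLocalization_apply, pb.basis_eq_pow, map_pow]

open Polynomial in
/-- The discriminant of an integral power basis is, up to sign, the norm of the different. -/
theorem Algebra.associated_discr_powerBasis_norm {A R : Type*} (K L : Type*) [CommRing A]
    [IsDomain A] [IsIntegrallyClosed A] [CommRing R] [IsDomain R] [Algebra A R] [Field K] [Field L]
    [Algebra A K] [Algebra R L] [Algebra K L] [Algebra A L] [IsScalarTower A K L] [IsScalarTower A R L]
    [IsFractionRing A K] [IsLocalization (Algebra.algebraMapSubmonoid R (nonZeroDivisors A)) L]
    [IsFractionRing R L] [Algebra.IsSeparable K L] (pb : PowerBasis A R) :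
    Associated (Algebra.norm A (aeval pb.gen (minpoly A pb.gen).derivative))
      (Algebra.discr A pb.basis) := by
  have := pb.finite
  have := Module.Free.of_basis pb.basis
  let pb' := pb.localizationLocalization K L
  have : Module.Finite K L := pb'.finite
  have h := Algebra.discr_powerBasis_eq_norm K pb'
  have h1 : Algebra.discr K pb'.basis = algebraMap A K (Algebra.discr A pb.basis) :=
    Algebra.discr_localizationLocalization A (nonZeroDivisors A) L pb.basis
  have hg : pb'.gen = algebraMap R L pb.gen := rfl
  rw [h1, hg, minpoly.isIntegrallyClosed_eq_field_fractions K L pb.isIntegral_gen, derivative_map,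
    aeval_map_algebraMap, aeval_algebraMap_apply,
    Algebra.norm_localization A (nonZeroDivisors A)] at h
  have h2 : Algebra.discr A pb.basis = (-1) ^ (Module.finrank K L * (Module.finrank K L - 1) / 2) *
      Algebra.norm A (aeval pb.gen (minpoly A pb.gen).derivative) := by
    apply IsFractionRing.injective A K
    rw [h]
    simp
  rw [h2]
  exact (associated_unit_mul_left _ _ (isUnit_one.neg.pow _)).symm

open Polynomial in
/-- An isomorphism modulo a sufficiently high power of `t` transports a generator of `R` to an
approximate root of its minimal polynomial, which can be corrected to an actual root. -/
theorem PowerBasis.exists_aeval_minpoly_eq_zero {A R S : Type*} [CommRing A] [CommRing R]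
    [CommRing S] [Algebra A R] [Algebra A S] (pb : PowerBasis A R) {t : A} {d l : ℕ}
    [HenselianRing S (Ideal.span {algebraMap A S t})]
    (hdeg : 2 ≤ (minpoly A pb.gen).natDegree) (hdl : d < l)
    (hdvd : aeval pb.gen (minpoly A pb.gen).derivative ^ 2 ∣ algebraMap A R (t ^ d))
    (φ : (R ⧸ Ideal.span {algebraMap A R (t ^ l)}) ≃ₐ[A]
      (S ⧸ Ideal.span {algebraMap A S (t ^ l)})) :
    ∃ c : S, aeval c (minpoly A pb.gen) = 0 := by
  nontriviality S
  set f := minpoly A pb.gen with hf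
  have hmonic : f.Monic := minpoly.monic pb.isIntegral_gen
  let πR := Ideal.Quotient.mkₐ A (Ideal.span {algebraMap A R (t ^ l)})
  let πS := Ideal.Quotient.mkₐ A (Ideal.span {algebraMap A S (t ^ l)})
  have hπS : Function.Surjective πS := Ideal.Quotient.mkₐ_surjective A _
  obtain ⟨b, hb⟩ := hπS (φ (πR pb.gen))
  have htr : ∀ p : A[X], πS (aeval b p) = φ (πR (aeval pb.gen p)) := fun p => by
    rw [← aeval_algHom_apply, hb, ← aeval_algHom_apply, ← aeval_algHom_apply]
  have hroot : algebraMap A S (t ^ l) ∣ aeval b f := by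
    rw [← Ideal.mem_span_singleton, ← Ideal.Quotient.eq_zero_iff_mem]
    exact (htr f).trans (by rw [hf, minpoly.aeval, map_zero, map_zero])
  obtain ⟨w, hw⟩ := hdvd
  obtain ⟨w', hw'⟩ := hπS (φ (πR w))
  have happrox : algebraMap A S (t ^ l) ∣
      aeval b f.derivative ^ 2 * w' - algebraMap A S (t ^ d) := by
    rw [← Ideal.mem_span_singleton, ← Ideal.Quotient.eq]
    change πS (aeval b f.derivative ^ 2 * w') = πS (algebraMap A S (t ^ d))
    calc πS (aeval b f.derivative ^ 2 * w')
        = φ (πR (aeval pb.gen f.derivative ^ 2 * w)) := by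
          simp only [map_mul πS, map_pow πS, htr, hw', map_mul πR, map_pow πR, map_mul φ, map_pow φ]
      _ = πS (algebraMap A S (t ^ d)) := by
          rw [← hw, AlgHom.commutes, AlgHom.commutes, AlgEquiv.commutes]
  obtain ⟨z, hz⟩ := happrox
  obtain ⟨x, hx⟩ := hroot
  obtain ⟨j, rfl⟩ := Nat.exists_eq_add_of_lt hdl
  set τ := algebraMap A S t with hτ
  have hunit : IsUnit (τ * (τ ^ j * z) + 1) :=
    Ideal.mem_jacobson_bot.1 (HenselianRing.jac (Ideal.mem_span_singleton_self τ)) _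
  obtain ⟨v, hv⟩ := hunit.exists_right_inv
  rw [map_pow, ← hτ] at hx hz
  rw [map_pow, ← hτ] at hz
  have hsq : aeval b f.derivative ^ 2 * (w' * v) = τ ^ d := by
    linear_combination v * hz + τ ^ d * hv
  obtain ⟨c, hc⟩ := HenselianRing.exists_isRoot_of_eval_eq_sq_mul
    (I := Ideal.span {τ}) (f := f.map (algebraMap A S)) (b := b)
    (e := τ * (τ ^ j * (w' * v) * x)) (by rwa [hmonic.natDegree_map])
    (Ideal.mul_mem_right _ _ (Ideal.mem_span_singleton_self τ))
    (by
      rw [derivative_map, eval_map_algebraMap, eval_map_algebraMap, hx]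
      linear_combination -τ ^ (j + 1) * x * hsq)
  exact ⟨c, by rw [← eval_map_algebraMap]; exact hc⟩



/-- Let `K = k((t))` and let `L, L'` be finite separable field extensions of `K` of the
same degree, with `O_L = k⟦t⟧[α]` (power basis `pb`) and discriminant exponent `d_L`.
If for some `l > d_L` there is a `k⟦t⟧`-algebra isomorphism
`O_L/(tˡ) ≅ O_{L'}/(tˡ)`, then `L ≅ L'` as `K`-algebras. -/
theorem stmt_8 (k : Type*) [Field k] (L L' : Type*) [Field L] [Field L']
    [Algebra (LaurentSeries k) L] [FiniteDimensional (LaurentSeries k) L]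
    [Algebra.IsSeparable (LaurentSeries k) L]
    [Algebra (LaurentSeries k) L'] [FiniteDimensional (LaurentSeries k) L']
    [Algebra.IsSeparable (LaurentSeries k) L']
    [Algebra (PowerSeries k) L] [IsScalarTower (PowerSeries k) (LaurentSeries k) L]
    [Algebra (PowerSeries k) L'] [IsScalarTower (PowerSeries k) (LaurentSeries k) L']
    (hdeg : Module.finrank (LaurentSeries k) L = Module.finrank (LaurentSeries k) L')
    (pb : PowerBasis (PowerSeries k) (integralClosure (PowerSeries k) L))
    (l : ℕ)
    (hl : (Algebra.discr (PowerSeries k) pb.basis).order < (l : ℕ∞))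
    (h : Nonempty ((integralClosure (PowerSeries k) L ⧸
        Ideal.span {algebraMap (PowerSeries k) (integralClosure (PowerSeries k) L)
          (PowerSeries.X ^ l)}) ≃ₐ[PowerSeries k]
      (integralClosure (PowerSeries k) L' ⧸
        Ideal.span {algebraMap (PowerSeries k) (integralClosure (PowerSeries k) L')
          (PowerSeries.X ^ l)}))) :
    Nonempty (L ≃ₐ[LaurentSeries k] L') := by
  let O := integralClosure (PowerSeries k) L
  let O' := integralClosure (PowerSeries k) L'
  have : IsFractionRing O L :=
    integralClosure.isFractionRing_of_finite_extension (LaurentSeries k) L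
  have : IsLocalization (Algebra.algebraMapSubmonoid O (nonZeroDivisors (PowerSeries k))) L :=
    IsIntegralClosure.isLocalization (PowerSeries k) (LaurentSeries k) L O
  have : IsDedekindDomain O := integralClosure.isDedekindDomain (PowerSeries k) (LaurentSeries k) L
  have : Module.Finite (PowerSeries k) O := pb.finite
  have : Module.Free (PowerSeries k) O := Module.Free.of_basis pb.basis
  have : Module.Finite (PowerSeries k) O' :=
    IsIntegralClosure.finite (PowerSeries k) (LaurentSeries k) L' O'
  have : FaithfulSMul (PowerSeries k) L' := by
    rw [faithfulSMul_iff_algebraMap_injective,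
      IsScalarTower.algebraMap_eq (PowerSeries k) (LaurentSeries k) L']
    exact (algebraMap (LaurentSeries k) L').injective.comp
      (IsFractionRing.injective (PowerSeries k) (LaurentSeries k))
  have : Module.Free (PowerSeries k) O' :=
    IsIntegralClosure.module_free (PowerSeries k) (LaurentSeries k) L' O'
  obtain ⟨φ⟩ := h
  let pbL := pb.localizationLocalization (LaurentSeries k) L
  have hminpoly : minpoly (LaurentSeries k) pbL.gen =
      (minpoly (PowerSeries k) pb.gen).map (algebraMap (PowerSeries k) (LaurentSeries k)) :=
    minpoly.isIntegrallyClosed_eq_field_fractions (LaurentSeries k) L pb.isIntegral_gen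
  have hmonic : (minpoly (PowerSeries k) pb.gen).Monic := minpoly.monic pb.isIntegral_gen
  suffices hroot : ∃ c : O', Polynomial.aeval c (minpoly (PowerSeries k) pb.gen) = 0 by
    obtain ⟨c, hc⟩ := hroot
    let ψ : L →ₐ[LaurentSeries k] L' := pbL.lift (algebraMap O' L' c) (by
      rw [hminpoly, Polynomial.aeval_map_algebraMap, Polynomial.aeval_algebraMap_apply, hc,
        map_zero])
    exact ⟨AlgEquiv.ofBijective ψ ⟨ψ.injective,
      (LinearMap.injective_iff_surjective_of_finrank_eq_finrank hdeg (f := ψ.toLinearMap)).1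
        ψ.injective⟩⟩
  rcases lt_or_ge (minpoly (PowerSeries k) pb.gen).natDegree 2 with hlt | hdeg2
  · have hpos := minpoly.natDegree_pos pb.isIntegral_gen
    have h1 : (minpoly (PowerSeries k) pb.gen).natDegree = 1 := by omega
    refine ⟨algebraMap (PowerSeries k) O' (-(minpoly (PowerSeries k) pb.gen).coeff 0), ?_⟩
    rw [Polynomial.aeval_algebraMap_apply, hmonic.as_sum, h1]
    simp
  have hfinrank : Module.finrank (PowerSeries k) O =
      (minpoly (PowerSeries k) pb.gen).natDegree := by
    rw [pb.finrank, pb.natDegree_minpoly]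
  have := IsAdicComplete.span_algebraMap_of_finite_free O (PowerSeries.X : PowerSeries k)
  have := IsAdicComplete.span_algebraMap_of_finite_free O' (PowerSeries.X : PowerSeries k)
  have hX : (PowerSeries.X : PowerSeries k) ≠ 0 := PowerSeries.X_ne_zero
  have hXO : algebraMap (PowerSeries k) O PowerSeries.X ≠ 0 :=
    (map_ne_zero_iff _ (FaithfulSMul.algebraMap_injective (PowerSeries k) O)).2 hX
  have : IsDiscreteValuationRing O := .of_isDedekindDomain_of_henselianRing hXO
  have hd0 : Algebra.discr (PowerSeries k) pb.basis ≠ 0 := by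
    intro h0
    rw [h0] at hl
    simp at hl
  obtain ⟨d, hd⟩ := IsDiscreteValuationRing.associated_pow_irreducible hd0
    PowerSeries.X_irreducible
  have hdl : d < l := by
    obtain ⟨u, hu⟩ := hd.symm
    rw [← hu, PowerSeries.order_mul, PowerSeries.order_X_pow] at hl
    exact_mod_cast le_self_add.trans_lt hl
  exact pb.exists_aeval_minpoly_eq_zero hdeg2 hdl
    (IsDiscreteValuationRing.sq_dvd_algebraMap_of_associated_norm (hfinrank ▸ hdeg2)
      PowerSeries.X_prime
      ((Algebra.associated_discr_powerBasis_norm (LaurentSeries k) L pb).trans hd)) φ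
end
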